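/- arXiv:1211.4469 — 2 statements merged into one kernel-verified Lean document; each statement's English description precedes it below -/
import Mathlib

section
/- Let S be a Polish space, ψ : S → [1,∞) a continuous gauge function, and P^ψ(S) the set of Borel probability measures μ on S such that ∫_S |f| dμ < ∞ for all f with f/ψ bounded and continuous. Endow P^ψ(S) with the topology of ψ-weak convergence: μ_n → μ iff ∫ f dμ_n → ∫ f dμ for all f with f/ψ bounded continuous. Suppose a total preorder ⪯ on P^ψ(S) is continuous in this topology and satisfies the independence axiom. Then there exists a function u : S → ℝ with u/ψ bounded and continuous, such that U(μ) = ∫_S u(z) dμ(z) is a numerical representation of ⪯ on P^ψ(S). -/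
open MeasureTheory Filter

/-- Convex combination (lottery) of two measures: `α • μ + (1-α) • ν`. -/
noncomputable def mix {S : Type*} [MeasurableSpace S] (α : ℝ) (μ ν : Measure S) : Measure S :=
  ENNReal.ofReal α • μ + ENNReal.ofReal (1 - α) • ν

/-- Strict preference associated with a weak preference relation `pref x y` (= "x ⪰ y"). -/
def StrictPref {X : Type*} (pref : X → X → Prop) (x y : X) : Prop :=
  pref x y ∧ ¬ pref y x

/-- `f` is a function such that `f/ψ` is bounded and continuous. -/
def CbPsi {S : Type*} [TopologicalSpace S] (ψ f : S → ℝ) : Prop :=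
  Continuous (fun z => f z / ψ z) ∧ ∃ C : ℝ, ∀ z, |f z / ψ z| ≤ C

/-- Membership in `P^ψ(S)`: probability measures integrating every `f` with `f/ψ`
bounded continuous. -/
def MemPpsi {S : Type*} [TopologicalSpace S] [MeasurableSpace S] (ψ : S → ℝ)
    (μ : Measure S) : Prop :=
  IsProbabilityMeasure μ ∧ ∀ f : S → ℝ, CbPsi ψ f → Integrable f μ

/-- ψ-weak convergence of a sequence of measures. -/
def PsiTendsto {S : Type*} [TopologicalSpace S] [MeasurableSpace S] (ψ : S → ℝ)
    (μs : ℕ → Measure S) (μ : Measure S) : Prop :=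
  ∀ f : S → ℝ, CbPsi ψ f →
    Tendsto (fun n => ∫ z, f z ∂(μs n)) atTop (nhds (∫ z, f z ∂μ))

section Abstract

variable {E : Type*} [AddCommGroup E] [Module ℝ E]

/-- A total preorder `R x y` (read `x ⪰ y`) on a convex set `K` which satisfies the independence
axiom and whose upper and lower sets are closed along segments. -/
structure IsMixturePreference (K : Set E) (R : E → E → Prop) : Prop where
  convex : Convex ℝ K
  total : ∀ x ∈ K, ∀ y ∈ K, R x y ∨ R y x
  trans : ∀ x ∈ K, ∀ y ∈ K, ∀ z ∈ K, R x y → R y z → R x z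
  indep : ∀ x ∈ K, ∀ y ∈ K, ∀ z ∈ K, ¬ R y x → ∀ t ∈ Set.Ioo (0 : ℝ) 1,
    ¬ R (t • y + (1 - t) • z) (t • x + (1 - t) • z)
  upper_closed : ∀ p ∈ K, ∀ q ∈ K, ∀ r ∈ K,
    (∃ᶠ s : ℝ in nhdsWithin 0 (Set.Ioi 0), R (s • p + (1 - s) • q) r) → R q r
  lower_closed : ∀ p ∈ K, ∀ q ∈ K, ∀ r ∈ K,
    (∃ᶠ s : ℝ in nhdsWithin 0 (Set.Ioi 0), R r (s • p + (1 - s) • q)) → R r q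

namespace IsMixturePreference

variable {K : Set E} {R : E → E → Prop}

lemma refl (h : IsMixturePreference K R) {x : E} (hx : x ∈ K) : R x x :=
  (h.total x hx x hx).elim id id

lemma mix_mem (h : IsMixturePreference K R) {x y : E} (hx : x ∈ K) (hy : y ∈ K) {t : ℝ}
    (ht : t ∈ Set.Ioo (0 : ℝ) 1) : t • x + (1 - t) • y ∈ K :=
  h.convex hx hy ht.1.le (by linarith [ht.2]) (by ring)

lemma eventually_Ioo : ∀ᶠ s : ℝ in nhdsWithin 0 (Set.Ioi 0), s ∈ Set.Ioo (0 : ℝ) 1 :=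
  Ioo_mem_nhdsGT one_pos

lemma weak_indep (h : IsMixturePreference K R) {x y z : E} (hx : x ∈ K) (hy : y ∈ K) (hz : z ∈ K)
    (hxy : R x y) {t : ℝ} (ht : t ∈ Set.Ioo (0 : ℝ) 1) :
    R (t • x + (1 - t) • z) (t • y + (1 - t) • z) := by
  by_cases hup : ∃ w ∈ K, ¬ R x w
  · obtain ⟨w, hw, hxw⟩ := hup
    refine h.upper_closed _ (h.mix_mem hw hz ht) _ (h.mix_mem hx hz ht) _ (h.mix_mem hy hz ht) ?_
    refine Eventually.frequently (eventually_Ioo.mono fun s hs => ?_)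
    have hws := h.mix_mem hw hx hs
    have h1 := h.indep w hw x hx x hx hxw s hs
    rw [show s • x + (1 - s) • x = x by module] at h1
    have h2 : ¬ R y (s • w + (1 - s) • x) := fun h3 => h1 (h.trans _ hx _ hy _ hws hxy h3)
    have h4 := h.indep _ hws _ hy z hz h2 t ht
    rw [show s • (t • w + (1 - t) • z) + (1 - s) • (t • x + (1 - t) • z)
      = t • (s • w + (1 - s) • x) + (1 - t) • z by module]
    exact (h.total _ (h.mix_mem hws hz ht) _ (h.mix_mem hy hz ht)).resolve_right h4
  by_cases hlo : ∃ w ∈ K, ¬ R w y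
  · obtain ⟨w, hw, hyw⟩ := hlo
    refine h.lower_closed _ (h.mix_mem hw hz ht) _ (h.mix_mem hy hz ht) _ (h.mix_mem hx hz ht) ?_
    refine Eventually.frequently (eventually_Ioo.mono fun s hs => ?_)
    have hws := h.mix_mem hw hy hs
    have h1 := h.indep y hy w hw y hy hyw s hs
    rw [show s • y + (1 - s) • y = y by module] at h1
    have h2 : ¬ R (s • w + (1 - s) • y) x := fun h3 => h1 (h.trans _ hws _ hx _ hy h3 hxy)
    have h4 := h.indep _ hx _ hws z hz h2 t ht
    rw [show s • (t • w + (1 - t) • z) + (1 - s) • (t • y + (1 - t) • z)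
      = t • (s • w + (1 - s) • y) + (1 - t) • z by module]
    exact (h.total _ (h.mix_mem hx hz ht) _ (h.mix_mem hws hz ht)).resolve_right h4
  push Not at hup hlo
  have hX := h.mix_mem hx hz ht
  have hY := h.mix_mem hy hz ht
  by_cases hyx : R y x
  · exact h.trans _ hX _ hx _ hY (h.trans _ hX _ hy _ hx (hlo _ hX) hyx) (hup _ hY)
  · exact (h.total _ hX _ hY).resolve_right (h.indep x hx y hy z hz hyx t ht)

lemma mix_mono (h : IsMixturePreference K R) {x y x' y' : E} (hx : x ∈ K) (hy : y ∈ K)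
    (hx' : x' ∈ K) (hy' : y' ∈ K) (hxy : R x y) (hxy' : R x' y') {t : ℝ}
    (ht : t ∈ Set.Ioo (0 : ℝ) 1) : R (t • x + (1 - t) • x') (t • y + (1 - t) • y') := by
  have ht' : 1 - t ∈ Set.Ioo (0 : ℝ) 1 := ⟨by linarith [ht.2], by linarith [ht.1]⟩
  have h2 := h.weak_indep hx' hy' hy hxy' ht'
  rw [sub_sub_cancel, add_comm, add_comm (_ • y')] at h2
  exact h.trans _ (h.mix_mem hx hx' ht) _ (h.mix_mem hy hx' ht) _ (h.mix_mem hy hy' ht)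
    (h.weak_indep hx hy hx' hxy ht) h2

/-- The convex cone generated by the differences `x - y` with `x ⪰ y`. -/
def cone (h : IsMixturePreference K R) : ConvexCone ℝ E where
  carrier := {w | ∃ t : ℝ, 0 < t ∧ ∃ x ∈ K, ∃ y ∈ K, R x y ∧ w = t • (x - y)}
  smul_mem' := by
    rintro c hc _ ⟨t, ht, x, hx, y, hy, hxy, rfl⟩
    exact ⟨c * t, mul_pos hc ht, x, hx, y, hy, hxy, smul_smul _ _ _⟩
  add_mem' := by
    rintro _ ⟨t, ht, x, hx, y, hy, hxy, rfl⟩ _ ⟨t', ht', x', hx', y', hy', hxy', rfl⟩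
    have hθ : t / (t + t') ∈ Set.Ioo (0 : ℝ) 1 :=
      ⟨by positivity, (div_lt_one (by positivity)).2 (by linarith)⟩
    refine ⟨t + t', by positivity, _, h.mix_mem hx hx' hθ, _, h.mix_mem hy hy' hθ,
      h.mix_mono hx hy hx' hy' hxy hxy' hθ, ?_⟩
    have : t + t' ≠ 0 := by positivity
    match_scalars <;> field_simp <;> ring

lemma sub_mem_cone (h : IsMixturePreference K R) {x y : E} (hx : x ∈ K) (hy : y ∈ K)
    (hxy : R x y) : x - y ∈ h.cone :=
  ⟨1, one_pos, x, hx, y, hy, hxy, (one_smul _ _).symm⟩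

lemma rel_of_sub_mem_cone (h : IsMixturePreference K R) {x y : E} (hx : x ∈ K) (hy : y ∈ K)
    (hxy : x - y ∈ h.cone) : R x y := by
  obtain ⟨s, hs, x', hx', y', hy', hR, heq⟩ := hxy
  by_contra hn
  have hθ : 1 / (1 + s) ∈ Set.Ioo (0 : ℝ) 1 :=
    ⟨by positivity, (div_lt_one (by positivity)).2 (by linarith)⟩
  have hs1 : 1 + s ≠ 0 := by positivity
  apply h.indep y hy x hx x' hx' hn _ hθ
  have hmono := h.mix_mono hx hx hx' hy' (h.refl hx) hR hθ
  convert hmono using 1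
  rw [sub_eq_iff_eq_add] at heq
  rw [heq]
  match_scalars <;> field_simp <;> ring

lemma exists_pos_sub_smul_mem_cone (h : IsMixturePreference K R) {a b x y : E} (ha : a ∈ K)
    (hb : b ∈ K) (hx : x ∈ K) (hy : y ∈ K) (hyx : ¬ R y x) :
    ∃ ε : ℝ, 0 < ε ∧ (x - y) - ε • (a - b) ∈ h.cone := by
  have hhalf : (1 / 2 : ℝ) ∈ Set.Ioo (0 : ℝ) 1 := by norm_num
  set m : E := (1 / 2 : ℝ) • x + (1 - 1 / 2 : ℝ) • y with hm
  have hmK : m ∈ K := h.mix_mem hx hy hhalf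
  have hym : ¬ R y m := by
    have := h.indep x hx y hy y hy hyx _ hhalf
    rwa [show (1 / 2 : ℝ) • y + (1 - 1 / 2 : ℝ) • y = y by module] at this
  have hmx : ¬ R m x := by
    have := h.indep x hx y hy x hx hyx _ hhalf
    rwa [show (1 / 2 : ℝ) • x + (1 - 1 / 2 : ℝ) • x = x by module,
      show (1 / 2 : ℝ) • y + (1 - 1 / 2 : ℝ) • x = m by rw [hm]; module] at this
  have h1 := not_frequently.1 (mt (h.lower_closed b hb x hx m hmK) hmx)
  have h2 := not_frequently.1 (mt (h.upper_closed a ha y hy m hmK) hym)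
  obtain ⟨s, hs1, hs2, hs⟩ := (h1.and (h2.and eventually_Ioo)).exists
  have hX := h.mix_mem hb hx hs
  have hY := h.mix_mem ha hy hs
  have hXY := h.trans _ hX _ hmK _ hY ((h.total _ hX _ hmK).resolve_right hs1)
    ((h.total _ hmK _ hY).resolve_right hs2)
  have hs' : 0 < 1 - s := by linarith [hs.2]
  refine ⟨s / (1 - s), div_pos hs.1 hs', ?_⟩
  have hmem := h.cone.smul_mem (inv_pos.2 hs') (h.sub_mem_cone hX hY hXY)
  convert hmem using 1
  match_scalars <;> field_simp

/-- The vectors that are dominated, in absolute value, by multiples of `e`. -/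
def orderIdeal (P : ConvexCone ℝ E) (h0 : (0 : E) ∈ P) (e : E) : Submodule ℝ E where
  carrier := {y | ∃ r : ℝ, r • e + y ∈ P ∧ r • e - y ∈ P}
  zero_mem' := ⟨0, by simpa using h0, by simpa using h0⟩
  add_mem' := by
    rintro y y' ⟨r, h1, h2⟩ ⟨r', h1', h2'⟩
    refine ⟨r + r', ?_, ?_⟩
    · convert P.add_mem h1 h1' using 1; module
    · convert P.add_mem h2 h2' using 1; module
  smul_mem' := by
    rintro c y ⟨r, h1, h2⟩
    rcases lt_trichotomy c 0 with hc | rfl | hc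
    · refine ⟨-c * r, ?_, ?_⟩
      · convert P.smul_mem (neg_pos.2 hc) h2 using 1; module
      · convert P.smul_mem (neg_pos.2 hc) h1 using 1; module
    · exact ⟨0, by simpa using h0, by simpa using h0⟩
    · refine ⟨c * r, ?_, ?_⟩
      · convert P.smul_mem hc h1 using 1; module
      · convert P.smul_mem hc h2 using 1; module

/-- The mixture space theorem: a preference on a convex set which satisfies independence and is
closed along segments is represented by a linear functional. -/
theorem exists_linear_representation (h : IsMixturePreference K R) :
    ∃ U : E →ₗ[ℝ] ℝ, ∀ x ∈ K, ∀ y ∈ K, R x y ↔ U y ≤ U x := by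
  by_cases hne : ∃ a ∈ K, ∃ b ∈ K, ¬ R b a
  swap
  · push Not at hne
    exact ⟨0, fun x hx y hy => by simpa using hne y hy x hx⟩
  obtain ⟨a, ha, b, hb, hab⟩ := hne
  have hRab := (h.total a ha b hb).resolve_right hab
  have h0 : (0 : E) ∈ h.cone := by simpa using h.sub_mem_cone ha ha (h.refl ha)
  set e : E := a - b with he
  have heP : e ∈ h.cone := h.sub_mem_cone ha hb hRab
  have hdom : ∀ x ∈ K, ∀ y ∈ K, ∃ r : ℝ, 0 ≤ r ∧ r • e + (x - y) ∈ h.cone := by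
    intro x hx y hy
    by_cases hxy : R x y
    · exact ⟨0, le_rfl, by simpa using h.sub_mem_cone hx hy hxy⟩
    obtain ⟨ε, hε, hmem⟩ := h.exists_pos_sub_smul_mem_cone hy hx ha hb hab
    refine ⟨ε⁻¹, by positivity, ?_⟩
    convert h.cone.smul_mem (inv_pos.2 hε) hmem using 1
    match_scalars <;> field_simp
  have hmono : ∀ (w : E) (r r' : ℝ), r ≤ r' → r • e + w ∈ h.cone → r' • e + w ∈ h.cone := by
    intro w r r' hrr hw
    rcases hrr.eq_or_lt with rfl | hlt
    · exact hw
    · convert h.cone.add_mem (h.cone.smul_mem (sub_pos.2 hlt) heP) hw using 1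
      module
  set W := orderIdeal h.cone h0 e
  have hKW : ∀ x ∈ K, ∀ y ∈ K, x - y ∈ W := by
    intro x hx y hy
    obtain ⟨r, -, hr⟩ := hdom x hx y hy
    obtain ⟨r', -, hr'⟩ := hdom y hy x hx
    refine ⟨max r r', hmono _ _ _ (le_max_left _ _) hr, ?_⟩
    rw [sub_eq_add_neg, neg_sub]
    exact hmono _ _ _ (le_max_right _ _) hr'
  let e' : W := ⟨e, hKW a ha b hb⟩
  have he' : e' ≠ 0 := by
    intro h1
    have h2 : a - b = 0 := congrArg Subtype.val h1
    rw [sub_eq_zero] at h2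
    exact hab (h2 ▸ h.refl ha)
  have hneg : ∀ r : ℝ, r • e ∈ h.cone → 0 ≤ r := by
    intro r hr
    by_contra! hlt
    apply hab
    apply h.rel_of_sub_mem_cone hb ha
    have hr0 : r ≠ 0 := hlt.ne
    convert h.cone.smul_mem (inv_pos.2 (neg_pos.2 hlt)) hr using 1
    rw [smul_smul, he, show (-r)⁻¹ * r = -1 by field_simp]
    module
  obtain ⟨g, hg1, hg2⟩ := riesz_extension
    ((h.cone.comap W.subtype).toPointedCone h0)
    (LinearPMap.mkSpanSingleton e' (1 : ℝ) he')
    (by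
      rintro ⟨x, hx⟩ hxP
      obtain ⟨r, rfl⟩ := Submodule.mem_span_singleton.1 hx
      refine le_of_le_of_eq ?_ (LinearPMap.mkSpanSingleton'_apply e' (1 : ℝ) _ r hx).symm
      simpa using hneg r hxP)
    (by
      rintro ⟨y, r, hr, -⟩
      exact ⟨⟨r • e', Submodule.mem_span_singleton.2 ⟨r, rfl⟩⟩, hr⟩)
  have hge : g e' = 1 := by
    rw [← one_smul ℝ e']
    refine (hg1 ⟨(1 : ℝ) • e', Submodule.mem_span_singleton.2 ⟨1, rfl⟩⟩).trans ?_
    exact (LinearPMap.mkSpanSingleton'_apply e' (1 : ℝ) _ 1 _).trans (one_smul ℝ 1)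
  obtain ⟨U, hU⟩ := g.exists_extend
  have hUW : ∀ w (hw : w ∈ W), U w = g ⟨w, hw⟩ := fun w hw => by rw [← hU]; rfl
  have hUe : U e = 1 := (hUW e e'.2).trans hge
  have hUP : ∀ w ∈ W, w ∈ h.cone → 0 ≤ U w := fun w hw hwP => by
    rw [hUW w hw]; exact hg2 ⟨w, hw⟩ hwP
  refine ⟨U, fun x hx y hy => ⟨fun hxy => ?_, fun hxy => ?_⟩⟩
  · have := hUP _ (hKW x hx y hy) (h.sub_mem_cone hx hy hxy)
    rw [map_sub] at this
    linarith
  · by_contra hn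
    obtain ⟨ε, hε, hmem⟩ := h.exists_pos_sub_smul_mem_cone ha hb hy hx hn
    have := hUP _ (W.sub_mem (hKW y hy x hx) (W.smul_mem ε e'.2)) hmem
    rw [map_sub, map_sub, map_smul, hUe, smul_eq_mul] at this
    linarith

end IsMixturePreference

end Abstract

section GaugeFunctions

variable {S : Type*} [TopologicalSpace S] {ψ : S → ℝ}

lemma CbPsi.continuous {f : S → ℝ} (hψcont : Continuous ψ) (hψone : ∀ z, 1 ≤ ψ z)
    (hf : CbPsi ψ f) : Continuous f := by
  have h : f = fun z => f z / ψ z * ψ z := by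
    ext z
    rw [div_mul_cancel₀ _ (by linarith [hψone z])]
  rw [h]
  exact hf.1.mul hψcont

lemma CbPsi.exists_bound {f : S → ℝ} (hψone : ∀ z, 1 ≤ ψ z) (hf : CbPsi ψ f) :
    ∃ C : ℝ, 0 ≤ C ∧ ∀ z, |f z| ≤ C * ψ z := by
  obtain ⟨C, hC⟩ := hf.2
  refine ⟨max C 0, le_max_right _ _, fun z => ?_⟩
  have hψ : 0 < ψ z := by linarith [hψone z]
  have := (hC z).trans (le_max_left C 0)
  rwa [abs_div, abs_of_pos hψ, div_le_iff₀ hψ] at this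

end GaugeFunctions

section Gauge

variable {S : Type*} [MeasurableSpace S]

/-- The vector of probabilities that a measure assigns to the measurable sets. -/
noncomputable def measureVector (μ : Measure S) : {s : Set S // MeasurableSet s} → ℝ :=
  fun s => μ.real s

lemma measureVector_injOn : Set.InjOn (measureVector (S := S)) {μ | IsFiniteMeasure μ} := by
  intro μ hμ ν hν h
  have : IsFiniteMeasure μ := hμ
  have : IsFiniteMeasure ν := hν
  ext s hs
  rw [← measureReal_eq_measureReal_iff]
  exact congrFun h ⟨s, hs⟩

lemma isProbabilityMeasure_mix {α : ℝ} (h0 : 0 ≤ α) (h1 : α ≤ 1) (μ ν : Measure S)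
    [IsProbabilityMeasure μ] [IsProbabilityMeasure ν] : IsProbabilityMeasure (mix α μ ν) := by
  constructor
  simp only [mix, Measure.add_apply, Measure.smul_apply, measure_univ, smul_eq_mul, mul_one]
  rw [← ENNReal.ofReal_add h0 (by linarith)]
  simp

lemma integrable_mix {α : ℝ} {μ ν : Measure S} {f : S → ℝ} (hμ : Integrable f μ)
    (hν : Integrable f ν) : Integrable f (mix α μ ν) :=
  (hμ.smul_measure ENNReal.ofReal_ne_top).add_measure (hν.smul_measure ENNReal.ofReal_ne_top)

lemma integral_mix {α : ℝ} (h0 : 0 ≤ α) (h1 : α ≤ 1) {μ ν : Measure S} {f : S → ℝ}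
    (hμ : Integrable f μ) (hν : Integrable f ν) :
    ∫ z, f z ∂(mix α μ ν) = α * ∫ z, f z ∂μ + (1 - α) * ∫ z, f z ∂ν := by
  rw [mix, integral_add_measure (hμ.smul_measure ENNReal.ofReal_ne_top)
    (hν.smul_measure ENNReal.ofReal_ne_top), integral_smul_measure, integral_smul_measure,
    ENNReal.toReal_ofReal h0, ENNReal.toReal_ofReal (by linarith), smul_eq_mul, smul_eq_mul]

lemma measureVector_mix {α : ℝ} (h0 : 0 ≤ α) (h1 : α ≤ 1) (μ ν : Measure S)
    [IsFiniteMeasure μ] [IsFiniteMeasure ν] :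
    measureVector (mix α μ ν) = α • measureVector μ + (1 - α) • measureVector ν := by
  ext s
  simp only [measureVector, mix, measureReal_def, Measure.add_apply, Measure.smul_apply,
    smul_eq_mul, Pi.add_apply, Pi.smul_apply]
  rw [ENNReal.toReal_add (by finiteness) (by finiteness), ENNReal.toReal_mul, ENNReal.toReal_mul,
    ENNReal.toReal_ofReal h0, ENNReal.toReal_ofReal (by linarith)]

lemma integral_comp_simpleFunc (T : SimpleFunc S S) (μ : Measure S) [IsFiniteMeasure μ]
    (g : S → ℝ) : ∫ z, g (T z) ∂μ = ∑ x ∈ T.range, μ.real (T ⁻¹' {x}) * g x := by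
  have hg : ∀ z, g (T z) = ∑ x ∈ T.range, (T ⁻¹' {x}).indicator (fun _ => g x) z := by
    intro z
    rw [Finset.sum_eq_single_of_mem (T z) (T.mem_range_self z)]
    · simp
    · intro x _ hx
      simp [hx.symm]
  simp_rw [hg]
  rw [integral_finsetSum _ fun x _ => (integrable_const (g x)).indicator (T.measurableSet_fiber x)]
  exact Finset.sum_congr rfl fun x _ => by
    rw [integral_indicator_const _ (T.measurableSet_fiber x), smul_eq_mul]

lemma measureVector_map_simpleFunc (T : SimpleFunc S S) (μ : Measure S) [IsFiniteMeasure μ] :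
    measureVector (μ.map T)
      = ∑ x ∈ T.range, μ.real (T ⁻¹' {x}) • measureVector (Measure.dirac x) := by
  ext ⟨s, hs⟩
  have h := integral_comp_simpleFunc T μ (s.indicator fun _ => 1)
  have h2 : (fun z => s.indicator (fun _ => (1 : ℝ)) (T z))
      = (T ⁻¹' s).indicator fun _ => (1 : ℝ) := rfl
  rw [h2, integral_indicator_const _ (T.measurable hs), smul_eq_mul, mul_one] at h
  simp only [measureVector, Finset.sum_apply, Pi.smul_apply, smul_eq_mul]
  rw [map_measureReal_apply T.measurable hs, h]
  refine Finset.sum_congr rfl fun x _ => ?_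
  congr 1
  by_cases hx : x ∈ s <;> simp [measureReal_def, Measure.dirac_apply' _ hs, hx]

variable [TopologicalSpace S] {ψ : S → ℝ}

lemma MemPpsi.integrable_gauge {μ : Measure S} (hψone : ∀ z, 1 ≤ ψ z) (hμ : MemPpsi ψ μ) :
    Integrable ψ μ := by
  have h : ∀ z, ψ z / ψ z = 1 := fun z => div_self (by linarith [hψone z])
  exact hμ.2 ψ ⟨by simpa only [h] using continuous_const, 1, fun z => by simp [h z]⟩

lemma memPpsi_of_integrable [BorelSpace S] {μ : Measure S} (hψcont : Continuous ψ)
    (hψone : ∀ z, 1 ≤ ψ z) (hμ : IsProbabilityMeasure μ) (hint : Integrable ψ μ) :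
    MemPpsi ψ μ := by
  refine ⟨hμ, fun f hf => ?_⟩
  obtain ⟨C, -, hC⟩ := hf.exists_bound hψone
  exact (hint.const_mul C).mono' (hf.continuous hψcont hψone).aestronglyMeasurable
    (Eventually.of_forall hC)

lemma MemPpsi.mix {μ ν : Measure S} {α : ℝ} (h0 : 0 ≤ α) (h1 : α ≤ 1) (hμ : MemPpsi ψ μ)
    (hν : MemPpsi ψ ν) : MemPpsi ψ (mix α μ ν) := by
  have := hμ.1
  have := hν.1
  exact ⟨isProbabilityMeasure_mix h0 h1 μ ν, fun f hf => integrable_mix (hμ.2 f hf) (hν.2 f hf)⟩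

lemma psiTendsto_mix {μ ν : Measure S} {α : ℕ → ℝ} (hα : ∀ n, α n ∈ Set.Icc (0 : ℝ) 1)
    (hlim : Tendsto α atTop (nhds 0)) (hμ : MemPpsi ψ μ) (hν : MemPpsi ψ ν) :
    PsiTendsto ψ (fun n => mix (α n) μ ν) ν := by
  intro f hf
  simp_rw [fun n => integral_mix (hα n).1 (hα n).2 (hμ.2 f hf) (hν.2 f hf)]
  simpa using (hlim.mul_const (∫ z, f z ∂μ)).add ((hlim.const_sub 1).mul_const (∫ z, f z ∂ν))

/-- The von Neumann–Morgenstern representation by a linear functional of the measure, with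
continuity of the preference required only along mixtures. -/
lemma exists_linear_measure_representation {pref : Measure S → Measure S → Prop}
    (htrans : ∀ μ ν ξ, MemPpsi ψ μ → MemPpsi ψ ν → MemPpsi ψ ξ →
      pref μ ν → pref ν ξ → pref μ ξ)
    (htotal : ∀ μ ν, MemPpsi ψ μ → MemPpsi ψ ν → pref μ ν ∨ pref ν μ)
    (hcont : ∀ μ, MemPpsi ψ μ → ∀ (νs : ℕ → Measure S) (ν : Measure S),
      (∀ n, MemPpsi ψ (νs n)) → MemPpsi ψ ν → PsiTendsto ψ νs ν →
      ((∀ n, pref μ (νs n)) → pref μ ν) ∧ ((∀ n, pref (νs n) μ) → pref ν μ))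
    (hind : ∀ μ ν ξ, MemPpsi ψ μ → MemPpsi ψ ν → MemPpsi ψ ξ → StrictPref pref μ ν →
      ∀ α ∈ Set.Ioo (0:ℝ) 1, StrictPref pref (mix α μ ξ) (mix α ν ξ)) :
    ∃ L : ({s : Set S // MeasurableSet s} → ℝ) →ₗ[ℝ] ℝ, ∀ μ ν, MemPpsi ψ μ → MemPpsi ψ ν →
      (pref μ ν ↔ L (measureVector ν) ≤ L (measureVector μ)) := by
  set M : Set (Measure S) := {μ | MemPpsi ψ μ}
  have hinj : Set.InjOn (measureVector (S := S)) M := measureVector_injOn.mono fun μ hμ => by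
    have := hμ.1
    exact inferInstanceAs (IsFiniteMeasure μ)
  have hmixv : ∀ μ ν, MemPpsi ψ μ → MemPpsi ψ ν → ∀ α ∈ Set.Icc (0 : ℝ) 1,
      α • measureVector μ + (1 - α) • measureVector ν = measureVector (mix α μ ν) := by
    intro μ ν hμ hν α hα
    have := hμ.1
    have := hν.1
    exact (measureVector_mix hα.1 hα.2 μ ν).symm
  set G := Function.invFunOn (measureVector (S := S)) M
  have hGv : ∀ μ, MemPpsi ψ μ → G (measureVector μ) = μ := fun μ hμ =>
    hinj.leftInvOn_invFunOn hμ
  have hseq : ∀ μ ν : Measure S, MemPpsi ψ μ → MemPpsi ψ ν → ∀ p : Measure S → Prop,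
      (∃ᶠ s : ℝ in nhdsWithin 0 (Set.Ioi 0),
        p (G (s • measureVector μ + (1 - s) • measureVector ν))) →
      ∃ νs : ℕ → Measure S, (∀ n, MemPpsi ψ (νs n)) ∧ PsiTendsto ψ νs ν ∧ ∀ n, p (νs n) := by
    intro μ ν hμ hν p hfreq
    obtain ⟨s, hs, hsp⟩ := exists_seq_forall_of_frequently
      (hfreq.and_eventually IsMixturePreference.eventually_Ioo)
    have hsI : ∀ n, s n ∈ Set.Icc (0 : ℝ) 1 := fun n => Set.Ioo_subset_Icc_self (hsp n).2
    refine ⟨fun n => mix (s n) μ ν, fun n => hμ.mix (hsI n).1 (hsI n).2 hν,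
      psiTendsto_mix hsI (hs.mono_right nhdsWithin_le_nhds) hμ hν, fun n => ?_⟩
    have := (hsp n).1
    rwa [hmixv μ ν hμ hν _ (hsI n), hGv _ (hμ.mix (hsI n).1 (hsI n).2 hν)] at this
  have hpref : IsMixturePreference (measureVector '' M) fun v w => pref (G v) (G w) := by
    constructor
    · rintro _ ⟨μ, hμ, rfl⟩ _ ⟨ν, hν, rfl⟩ a b ha hb hab
      obtain rfl : b = 1 - a := by linarith
      have ha1 : a ≤ 1 := by linarith
      exact ⟨mix a μ ν, hμ.mix ha ha1 hν, (hmixv μ ν hμ hν a ⟨ha, ha1⟩).symm⟩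
    · rintro _ ⟨μ, hμ, rfl⟩ _ ⟨ν, hν, rfl⟩
      rw [hGv μ hμ, hGv ν hν]
      exact htotal μ ν hμ hν
    · rintro _ ⟨μ, hμ, rfl⟩ _ ⟨ν, hν, rfl⟩ _ ⟨ξ, hξ, rfl⟩
      rw [hGv μ hμ, hGv ν hν, hGv ξ hξ]
      exact htrans μ ν ξ hμ hν hξ
    · rintro _ ⟨μ, hμ, rfl⟩ _ ⟨ν, hν, rfl⟩ _ ⟨ξ, hξ, rfl⟩ hn t ht
      have htI := Set.Ioo_subset_Icc_self ht
      rw [hGv μ hμ, hGv ν hν] at hn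
      rw [hmixv ν ξ hν hξ t htI, hmixv μ ξ hμ hξ t htI, hGv _ (MemPpsi.mix htI.1 htI.2 hν hξ),
        hGv _ (MemPpsi.mix htI.1 htI.2 hμ hξ)]
      exact (hind μ ν ξ hμ hν hξ ⟨(htotal μ ν hμ hν).resolve_right hn, hn⟩ t ht).2
    · rintro _ ⟨μ, hμ, rfl⟩ _ ⟨ν, hν, rfl⟩ _ ⟨ξ, hξ, rfl⟩ hfreq
      rw [hGv ν hν, hGv ξ hξ]
      rw [hGv ξ hξ] at hfreq
      obtain ⟨νs, h1, h2, h3⟩ := hseq μ ν hμ hν (fun η => pref η ξ) hfreq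
      exact (hcont ξ hξ νs ν h1 hν h2).2 h3
    · rintro _ ⟨μ, hμ, rfl⟩ _ ⟨ν, hν, rfl⟩ _ ⟨ξ, hξ, rfl⟩ hfreq
      rw [hGv ν hν, hGv ξ hξ]
      rw [hGv ξ hξ] at hfreq
      obtain ⟨νs, h1, h2, h3⟩ := hseq μ ν hμ hν (fun η => pref ξ η) hfreq
      exact (hcont ξ hξ νs ν h1 hν h2).1 h3
  obtain ⟨L, hL⟩ := hpref.exists_linear_representation
  refine ⟨L, fun μ ν hμ hν => ?_⟩
  have := hL _ ⟨μ, hμ, rfl⟩ _ ⟨ν, hν, rfl⟩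
  rwa [hGv μ hμ, hGv ν hν] at this

/-- An affine functional with sequentially closed lower sets is sequentially lower
semicontinuous. -/
lemma eventually_lt_of_psiTendsto {U : Measure S → ℝ}
    (hmix : ∀ μ ν, MemPpsi ψ μ → MemPpsi ψ ν → ∀ α ∈ Set.Icc (0 : ℝ) 1,
      U (mix α μ ν) = α * U μ + (1 - α) * U ν)
    (hclosed : ∀ ξ, MemPpsi ψ ξ → ∀ (νs : ℕ → Measure S) (ν : Measure S),
      (∀ n, MemPpsi ψ (νs n)) → MemPpsi ψ ν → PsiTendsto ψ νs ν →
      (∀ n, U (νs n) ≤ U ξ) → U ν ≤ U ξ)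
    {νs : ℕ → Measure S} {ν : Measure S} (hνs : ∀ n, MemPpsi ψ (νs n)) (hν : MemPpsi ψ ν)
    (hlim : PsiTendsto ψ νs ν) {c : ℝ} (hc : c < U ν) : ∀ᶠ n in atTop, c < U (νs n) := by
  by_contra hn
  obtain ⟨k, hk, hkc⟩ := extraction_of_frequently_atTop (not_eventually.1 hn)
  simp only [not_lt] at hkc
  have hpos : 0 < U ν - U (νs (k 0)) := by linarith [hkc 0]
  set α := (U ν - c) / (U ν - U (νs (k 0))) with hα
  have hαI : α ∈ Set.Icc (0 : ℝ) 1 :=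
    ⟨div_nonneg (by linarith) hpos.le, (div_le_one hpos).2 (by linarith [hkc 0])⟩
  have hU : U (mix α (νs (k 0)) ν) = c := by
    have : α * (U ν - U (νs (k 0))) = U ν - c := div_mul_cancel₀ _ hpos.ne'
    rw [hmix _ _ (hνs _) hν α hαI]
    linarith
  have := hclosed _ ((hνs (k 0)).mix hαI.1 hαI.2 hν) (fun n => νs (k n)) ν (fun n => hνs _) hν
    (fun f hf => (hlim f hf).comp hk.tendsto_atTop) fun n => (hkc n).trans_eq hU.symm
  linarith

lemma tendsto_of_psiTendsto {U : Measure S → ℝ}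
    (hmix : ∀ μ ν, MemPpsi ψ μ → MemPpsi ψ ν → ∀ α ∈ Set.Icc (0 : ℝ) 1,
      U (mix α μ ν) = α * U μ + (1 - α) * U ν)
    (hclosed : ∀ ξ, MemPpsi ψ ξ → ∀ (νs : ℕ → Measure S) (ν : Measure S),
      (∀ n, MemPpsi ψ (νs n)) → MemPpsi ψ ν → PsiTendsto ψ νs ν →
      ((∀ n, U (νs n) ≤ U ξ) → U ν ≤ U ξ) ∧ ((∀ n, U ξ ≤ U (νs n)) → U ξ ≤ U ν))
    {νs : ℕ → Measure S} {ν : Measure S} (hνs : ∀ n, MemPpsi ψ (νs n)) (hν : MemPpsi ψ ν)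
    (hlim : PsiTendsto ψ νs ν) : Tendsto (fun n => U (νs n)) atTop (nhds (U ν)) := by
  refine tendsto_order.2 ⟨fun c hc => ?_, fun c hc => ?_⟩
  · exact eventually_lt_of_psiTendsto hmix
      (fun ξ hξ νs ν h1 h2 h3 => (hclosed ξ hξ νs ν h1 h2 h3).1) hνs hν hlim hc
  · have := eventually_lt_of_psiTendsto (U := fun μ => -U μ)
      (fun μ ν hμ hν α hα => by rw [hmix μ ν hμ hν α hα]; ring)
      (fun ξ hξ νs ν h1 h2 h3 h4 => neg_le_neg
        ((hclosed ξ hξ νs ν h1 h2 h3).2 fun n => neg_le_neg_iff.1 (h4 n)))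
      hνs hν hlim (neg_lt_neg hc)
    simpa using this

/-- Simple functions converging pointwise to the identity with controlled gauge. -/
lemma exists_simpleFunc_tendsto_id [PolishSpace S] [BorelSpace S] (hψcont : Continuous ψ)
    (z₀ : S) : ∃ T : ℕ → SimpleFunc S S, (∀ z, Tendsto (fun n => T n z) atTop (nhds z)) ∧
      ∀ n z, ψ (T n z) ≤ max (ψ z + 1) (ψ z₀) := by
  let _ := TopologicalSpace.upgradeIsCompletelyMetrizable S
  let A : ℕ → SimpleFunc S S :=
    SimpleFunc.approxOn (id : S → S) measurable_id Set.univ z₀ (Set.mem_univ _)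
  have hA : ∀ z, Tendsto (fun n => A n z) atTop (nhds z) := fun z =>
    SimpleFunc.tendsto_approxOn measurable_id (Set.mem_univ _) (by simp)
  have hmeas : ∀ n, MeasurableSet {z | ψ (A n z) ≤ ψ z + 1} := fun n =>
    measurableSet_le (hψcont.measurable.comp (A n).measurable)
      (hψcont.measurable.add_const 1)
  refine ⟨fun n => (A n).piecewise _ (hmeas n) (SimpleFunc.const S z₀), fun z => ?_, fun n z => ?_⟩
  · refine (hA z).congr' ?_
    have hev := ((hψcont.tendsto z).comp (hA z)).eventually_lt_const (lt_add_one (ψ z))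
    filter_upwards [hev] with n hn
    exact (Set.piecewise_eq_of_mem _ _ _ (show z ∈ {z | ψ (A n z) ≤ ψ z + 1} from hn.le)).symm
  · rw [SimpleFunc.piecewise_apply]
    split_ifs with h
    · exact le_max_of_le_left h
    · exact le_max_right _ _

lemma memPpsi_dirac [BorelSpace S] (hψcont : Continuous ψ)
    (hψone : ∀ z, 1 ≤ ψ z) (z : S) : MemPpsi ψ (Measure.dirac z) :=
  memPpsi_of_integrable hψcont hψone inferInstance
    (integrable_dirac' hψcont.stronglyMeasurable enorm_lt_top)

lemma integral_mix_dirac [BorelSpace S] {f : S → ℝ} (hf : Continuous f) {α : ℝ} (h0 : 0 ≤ α)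
    (h1 : α ≤ 1) (x y : S) :
    ∫ z, f z ∂(mix α (Measure.dirac x) (Measure.dirac y)) = α * f x + (1 - α) * f y := by
  rw [integral_mix h0 h1 (integrable_dirac' hf.stronglyMeasurable enorm_lt_top)
    (integrable_dirac' hf.stronglyMeasurable enorm_lt_top),
    integral_dirac' f _ hf.stronglyMeasurable, integral_dirac' f _ hf.stronglyMeasurable]

/-- A sequentially continuous affine functional is bounded on Dirac masses by a multiple of the
gauge. -/
lemma exists_bound_dirac [BorelSpace S] (hψcont : Continuous ψ)
    (hψone : ∀ z, 1 ≤ ψ z) {U : Measure S → ℝ}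
    (hmix : ∀ μ ν, MemPpsi ψ μ → MemPpsi ψ ν → ∀ α ∈ Set.Icc (0 : ℝ) 1,
      U (mix α μ ν) = α * U μ + (1 - α) * U ν)
    (hU : ∀ (νs : ℕ → Measure S) (ν : Measure S), (∀ n, MemPpsi ψ (νs n)) → MemPpsi ψ ν →
      PsiTendsto ψ νs ν → Tendsto (fun n => U (νs n)) atTop (nhds (U ν))) :
    ∃ C : ℝ, ∀ z, |U (Measure.dirac z) / ψ z| ≤ C := by
  by_contra! hn
  choose z hz using fun n : ℕ => hn ((n : ℝ) + 1)
  have hψpos : ∀ z, 0 < ψ z := fun z => by linarith [hψone z]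
  have hD := memPpsi_dirac hψcont hψone
  set α : ℕ → ℝ := fun n => 1 / ((n : ℝ) + 1) / ψ (z n) with hα
  have hα0 : ∀ n, 0 ≤ α n := fun n => div_nonneg (by positivity) (hψpos _).le
  have hαle : ∀ n, α n ≤ 1 / ((n : ℝ) + 1) := fun n =>
    div_le_self (by positivity) (hψone _)
  have hα1 : ∀ n, α n ≤ 1 := fun n => (hαle n).trans
    ((div_le_one (by positivity)).2 (by linarith [n.cast_nonneg (α := ℝ)]))
  have hαlim : Tendsto α atTop (nhds 0) :=
    squeeze_zero hα0 hαle tendsto_one_div_add_atTop_nhds_zero_nat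
  have hlim : PsiTendsto ψ (fun n => mix (α n) (Measure.dirac (z n)) (Measure.dirac (z 0)))
      (Measure.dirac (z 0)) := by
    intro f hf
    have hfc := hf.continuous hψcont hψone
    simp_rw [fun n => integral_mix_dirac hfc (hα0 n) (hα1 n) (z n) (z 0)]
    rw [integral_dirac' f _ hfc.stronglyMeasurable]
    obtain ⟨C, hC0, hC⟩ := hf.exists_bound hψone
    have h1 : Tendsto (fun n => α n * f (z n)) atTop (nhds 0) := by
      refine squeeze_zero_norm (a := fun n : ℕ => C * (1 / ((n : ℝ) + 1))) (fun n => ?_) ?_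
      · rw [Real.norm_eq_abs, abs_mul, abs_of_nonneg (hα0 n)]
        calc α n * |f (z n)| ≤ α n * (C * ψ (z n)) := by gcongr; exacts [hα0 n, hC _]
          _ = C * (1 / ((n : ℝ) + 1)) := by
            have := (hψpos (z n)).ne'
            simp only [hα]; field_simp
      · simpa using tendsto_one_div_add_atTop_nhds_zero_nat.const_mul C
    simpa using h1.add ((hαlim.const_sub 1).mul_const (f (z 0)))
  have h2 := hU _ _ (fun n => (hD (z n)).mix (hα0 n) (hα1 n) (hD (z 0))) (hD (z 0)) hlim
  simp_rw [fun n => hmix _ _ (hD (z n)) (hD (z 0)) (α n) ⟨hα0 n, hα1 n⟩] at h2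
  have h3 : Tendsto (fun n => α n * U (Measure.dirac (z n))) atTop (nhds 0) := by
    simpa using h2.sub ((hαlim.const_sub 1).mul_const (U (Measure.dirac (z 0))))
  obtain ⟨n, hn1⟩ := ((h3.abs).eventually_lt_const (by simp : |(0 : ℝ)| < 1)).exists
  have h4 := hz n
  have hn0 : (0 : ℝ) < (n : ℝ) + 1 := by positivity
  have h5 : α n * U (Measure.dirac (z n))
      = U (Measure.dirac (z n)) / ψ (z n) / ((n : ℝ) + 1) := by
    have := (hψpos (z n)).ne'
    simp only [hα]; field_simp
  rw [h5, abs_div, abs_of_pos hn0, div_lt_one hn0] at hn1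
  linarith

end Gauge

/-- Expected utility representation on `P^ψ(S)` with a gauge function `ψ`: the utility
function `u` may be unbounded, but `u/ψ` is bounded and continuous. -/
theorem exists_expected_utility_representation_gauge
    {S : Type*} [MeasurableSpace S] [TopologicalSpace S] [PolishSpace S] [BorelSpace S]
    (ψ : S → ℝ) (hψcont : Continuous ψ) (hψone : ∀ z, 1 ≤ ψ z)
    (pref : Measure S → Measure S → Prop)
    (hrefl : ∀ μ, MemPpsi ψ μ → pref μ μ)
    (htrans : ∀ μ ν ξ, MemPpsi ψ μ → MemPpsi ψ ν → MemPpsi ψ ξ →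
      pref μ ν → pref ν ξ → pref μ ξ)
    (htotal : ∀ μ ν, MemPpsi ψ μ → MemPpsi ψ ν → pref μ ν ∨ pref ν μ)
    (hcont : ∀ μ, MemPpsi ψ μ → ∀ (νs : ℕ → Measure S) (ν : Measure S),
      (∀ n, MemPpsi ψ (νs n)) → MemPpsi ψ ν → PsiTendsto ψ νs ν →
      ((∀ n, pref μ (νs n)) → pref μ ν) ∧ ((∀ n, pref (νs n) μ) → pref ν μ))
    (hind : ∀ μ ν ξ, MemPpsi ψ μ → MemPpsi ψ ν → MemPpsi ψ ξ → StrictPref pref μ ν →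
      ∀ α ∈ Set.Ioo (0:ℝ) 1, StrictPref pref (mix α μ ξ) (mix α ν ξ)) :
    ∃ u : S → ℝ, CbPsi ψ u ∧
      ∀ μ ν : Measure S, MemPpsi ψ μ → MemPpsi ψ ν →
        (StrictPref pref μ ν ↔ ∫ z, u z ∂μ > ∫ z, u z ∂ν) := by
  obtain ⟨L, hL⟩ := exists_linear_measure_representation htrans htotal hcont hind
  set U : Measure S → ℝ := fun μ => L (measureVector μ) with hU
  have hmix : ∀ μ ν, MemPpsi ψ μ → MemPpsi ψ ν → ∀ α ∈ Set.Icc (0 : ℝ) 1,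
      U (mix α μ ν) = α * U μ + (1 - α) * U ν := by
    intro μ ν hμ hν α hα
    have := hμ.1
    have := hν.1
    simp only [hU, measureVector_mix hα.1 hα.2, map_add, map_smul, smul_eq_mul]
  have hlim : ∀ (νs : ℕ → Measure S) (ν : Measure S), (∀ n, MemPpsi ψ (νs n)) → MemPpsi ψ ν →
      PsiTendsto ψ νs ν → Tendsto (fun n => U (νs n)) atTop (nhds (U ν)) := by
    refine fun νs ν h1 h2 h3 => tendsto_of_psiTendsto hmix (fun ξ hξ νs ν h1 h2 h3 => ?_) h1 h2 h3
    simp only [hU, fun n => (hL ξ (νs n) hξ (h1 n)).symm, fun n => (hL (νs n) ξ (h1 n) hξ).symm,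
      ← hL ξ ν hξ h2, ← hL ν ξ h2 hξ]
    exact hcont ξ hξ νs ν h1 h2 h3
  have hD := memPpsi_dirac hψcont hψone
  have hucont : Continuous fun z => U (Measure.dirac z) := by
    let _ := TopologicalSpace.upgradeIsCompletelyMetrizable S
    refine continuous_iff_seqContinuous.2 fun x z hx => ?_
    refine hlim _ _ (fun n => hD (x n)) (hD z) fun f hf => ?_
    have hfc := hf.continuous hψcont hψone
    simp_rw [fun z => integral_dirac' f z hfc.stronglyMeasurable]
    exact (hfc.tendsto z).comp hx
  have hu : CbPsi ψ fun z => U (Measure.dirac z) :=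
    ⟨hucont.div hψcont fun z => by linarith [hψone z], exists_bound_dirac hψcont hψone hmix hlim⟩
  have hint : ∀ μ, MemPpsi ψ μ → U μ = ∫ z, U (Measure.dirac z) ∂μ := by
    intro μ hμ
    have := hμ.1
    obtain ⟨z₀⟩ : Nonempty S := μ.nonempty_of_neZero
    obtain ⟨T, hT, hTψ⟩ := exists_simpleFunc_tendsto_id hψcont z₀
    have hbound : Integrable (fun z => max (ψ z + 1) (ψ z₀)) μ :=
      ((hμ.integrable_gauge hψone).add (integrable_const 1)).sup (integrable_const _)
    have hmap : ∀ n, MemPpsi ψ (μ.map (T n)) := by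
      intro n
      refine memPpsi_of_integrable hψcont hψone
        (Measure.isProbabilityMeasure_map (T n).aemeasurable) ?_
      rw [integrable_map_measure hψcont.aestronglyMeasurable (T n).aemeasurable]
      refine hbound.mono' (hψcont.measurable.comp (T n).measurable).aestronglyMeasurable
        (Eventually.of_forall fun z => ?_)
      rw [Function.comp_apply, Real.norm_eq_abs, abs_of_nonneg (by linarith [hψone (T n z)])]
      exact hTψ n z
    have hconv : PsiTendsto ψ (fun n => μ.map (T n)) μ := by
      intro f hf
      have hfc := hf.continuous hψcont hψone
      obtain ⟨C, hC0, hC⟩ := hf.exists_bound hψone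
      simp_rw [fun n => integral_map (T n).aemeasurable (hfc.aestronglyMeasurable (μ := μ.map (T n)))]
      refine tendsto_integral_of_dominated_convergence _
        (fun n => (hfc.measurable.comp (T n).measurable).aestronglyMeasurable)
        (hbound.const_mul C)
        (fun n => Eventually.of_forall fun z =>
          (hC _).trans (mul_le_mul_of_nonneg_left (hTψ n z) hC0))
        (Eventually.of_forall fun z => (hfc.tendsto z).comp (hT z))
    have hUT : ∀ n, U (μ.map (T n)) = ∫ z, U (Measure.dirac z) ∂(μ.map (T n)) := by
      intro n
      rw [integral_map (T n).aemeasurable hucont.aestronglyMeasurable,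
        integral_comp_simpleFunc (T n) μ fun z => U (Measure.dirac z)]
      simp only [hU, measureVector_map_simpleFunc, map_sum, map_smul, smul_eq_mul]
    exact tendsto_nhds_unique (hlim _ _ hmap hμ hconv)
      ((hconv _ hu).congr fun n => (hUT n).symm)
  refine ⟨fun z => U (Measure.dirac z), hu, fun μ ν hμ hν => ?_⟩
  rw [← hint μ hμ, ← hint ν hν, StrictPref, hL μ ν hμ hν, hL ν μ hν hμ, not_le]
  exact ⟨fun h => h.2, fun h => ⟨h.le, h⟩⟩
end

section
/- Let Σ be the algebra of subsets of (0,1] generated by half-open intervals (a,b], and Q_b the set of bounded, nondecreasing, left-continuous functions on (0,1], viewed inside the Banach space B((0,1],Σ) of uniform limits of Σ-simple functions with the supremum norm. Suppose a total preorder ⪯ on Q_b is continuous, monotonic, and satisfies the dual independence axiom. Then there exists a nonnegative, bounded, finitely additive set function μ on Σ and a supremum-norm-continuous linear functional U on B((0,1],Σ) whose restriction to Q_b is a numerical representation of ⪯, such that U(∑_{i=1}^n α_i 1_{A_i}) = ∑_{i=1}^n α_i μ(A_i) for every Σ-simple function with disjoint A_i ∈ Σ (i.e., U is the integral with respect to μ).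 -/
open scoped BigOperators

/-- The algebra `Σ` of subsets of `(0,1]` generated by the half-open intervals `(a,b]`:
its elements are the finite unions of such intervals. -/
def SigmaAlg : Set (Set ℝ) :=
  {A | ∃ s : Finset (ℝ × ℝ), (∀ q ∈ s, 0 ≤ q.1 ∧ q.2 ≤ 1) ∧
    A = ⋃ q ∈ s, Set.Ioc q.1 q.2}

/-- A `Σ`-simple function on `(0,1]`: a finite linear combination of indicator functions
of disjoint sets in `Σ`. -/
def IsSimpleFn (f : ℝ → ℝ) : Prop :=
  ∃ (n : ℕ) (c : Fin n → ℝ) (A : Fin n → Set ℝ),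
    (∀ i, A i ∈ SigmaAlg) ∧ (∀ i j, i ≠ j → Disjoint (A i) (A j)) ∧
    ∀ p ∈ Set.Ioc (0:ℝ) 1, f p = ∑ i, Set.indicator (A i) (fun _ => c i) p

/-- Uniform convergence on `(0,1]`. -/
def UnifTendsto (fs : ℕ → ℝ → ℝ) (f : ℝ → ℝ) : Prop :=
  ∀ ε > (0:ℝ), ∃ N, ∀ n ≥ N, ∀ p ∈ Set.Ioc (0:ℝ) 1, |fs n p - f p| ≤ ε

/-- The space `B((0,1],Σ)` of bounded functions on `(0,1]` that are uniform limits of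
`Σ`-simple functions. -/
def BSpace : Set (ℝ → ℝ) :=
  {f | ∃ g : ℕ → ℝ → ℝ, (∀ n, IsSimpleFn (g n)) ∧ UnifTendsto g f}

/-- The supremum norm over `(0,1]`. -/
noncomputable def supAbs (f : ℝ → ℝ) : ℝ :=
  ⨆ p : Set.Ioc (0:ℝ) 1, |f p.1|

/-- The prospect space `Q_b` of bounded, nondecreasing, left-continuous functions
on `(0,1]`. -/
def Qb : Set (ℝ → ℝ) :=
  {Φ | (∃ C : ℝ, ∀ p ∈ Set.Ioc (0:ℝ) 1, |Φ p| ≤ C) ∧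
    MonotoneOn Φ (Set.Ioc 0 1) ∧
    ∀ p ∈ Set.Ioc (0:ℝ) 1, ContinuousWithinAt Φ (Set.Iio p) p}

open Set Filter Topology

section ProspectSpace

lemma const_mem_Qb (c : ℝ) : (fun _ => c) ∈ Qb :=
  ⟨⟨|c|, fun _ _ => le_rfl⟩, monotoneOn_const, fun _ _ => continuousWithinAt_const⟩

lemma add_mem_Qb {Φ Ψ : ℝ → ℝ} (hΦ : Φ ∈ Qb) (hΨ : Ψ ∈ Qb) : (fun p => Φ p + Ψ p) ∈ Qb := by
  obtain ⟨⟨C, hC⟩, hm, hc⟩ := hΦ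
  obtain ⟨⟨D, hD⟩, hm', hc'⟩ := hΨ
  exact ⟨⟨C + D, fun p hp => (abs_add_le _ _).trans (add_le_add (hC p hp) (hD p hp))⟩,
    hm.add hm', fun p hp => (hc p hp).add (hc' p hp)⟩

lemma const_mul_mem_Qb {Φ : ℝ → ℝ} (hΦ : Φ ∈ Qb) {t : ℝ} (ht : 0 ≤ t) :
    (fun p => t * Φ p) ∈ Qb := by
  obtain ⟨⟨C, hC⟩, hm, hc⟩ := hΦ
  refine ⟨⟨t * C, fun p hp => ?_⟩, fun p hp q hq hpq => ?_, fun p hp => ?_⟩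
  · rw [abs_mul, abs_of_nonneg ht]
    exact mul_le_mul_of_nonneg_left (hC p hp) ht
  · exact mul_le_mul_of_nonneg_left (hm hp hq hpq) ht
  · exact continuousWithinAt_const.mul (hc p hp)

lemma mix_mem_Qb {Φ Ψ : ℝ → ℝ} (hΦ : Φ ∈ Qb) (hΨ : Ψ ∈ Qb) {α : ℝ} (hα : α ∈ Ioo (0 : ℝ) 1) :
    (fun p => α * Φ p + (1 - α) * Ψ p) ∈ Qb :=
  add_mem_Qb (const_mul_mem_Qb hΦ hα.1.le) (const_mul_mem_Qb hΨ (sub_pos.2 hα.2).le)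

lemma unifTendsto_add_const_div {Φ : ℝ → ℝ} (c : ℝ) :
    UnifTendsto (fun n p => Φ p + c * (1 / ((n : ℝ) + 1))) Φ := by
  intro ε hε
  have h : Tendsto (fun n : ℕ => c * (1 / ((n : ℝ) + 1))) atTop (𝓝 (c * 0)) :=
    tendsto_one_div_add_atTop_nhds_zero_nat.const_mul c
  rw [mul_zero] at h
  obtain ⟨N, hN⟩ := Metric.tendsto_atTop.1 h ε hε
  refine ⟨N, fun n hn p _ => ?_⟩
  have := hN n hn
  rw [Real.dist_0_eq_abs] at this
  simpa using this.le

end ProspectSpace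

section Preference

/-- A continuous, monotonic total preorder on `Q_b` satisfying dual independence. -/
structure IsDualPref (pref : (ℝ → ℝ) → (ℝ → ℝ) → Prop) : Prop where
  refl : ∀ Φ ∈ Qb, pref Φ Φ
  trans : ∀ Φ Ψ Υ, Φ ∈ Qb → Ψ ∈ Qb → Υ ∈ Qb → pref Φ Ψ → pref Ψ Υ → pref Φ Υ
  total : ∀ Φ Ψ, Φ ∈ Qb → Ψ ∈ Qb → pref Φ Ψ ∨ pref Ψ Φ
  mono : ∀ Φ Ψ, Φ ∈ Qb → Ψ ∈ Qb → (∀ p ∈ Ioc (0 : ℝ) 1, Ψ p ≤ Φ p) → pref Φ Ψ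
  cont : ∀ Φ ∈ Qb, ∀ (Ψs : ℕ → ℝ → ℝ) (Ψ : ℝ → ℝ), (∀ n, Ψs n ∈ Qb) → Ψ ∈ Qb →
    UnifTendsto Ψs Ψ →
    ((∀ n, pref Φ (Ψs n)) → pref Φ Ψ) ∧ ((∀ n, pref (Ψs n) Φ) → pref Ψ Φ)
  ind : ∀ Φ Ψ Υ, Φ ∈ Qb → Ψ ∈ Qb → Υ ∈ Qb → StrictPref pref Φ Ψ →
    ∀ α ∈ Ioo (0 : ℝ) 1,
      StrictPref pref (fun p => α * Φ p + (1 - α) * Υ p) (fun p => α * Ψ p + (1 - α) * Υ p)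

variable {pref : (ℝ → ℝ) → (ℝ → ℝ) → Prop}

namespace IsDualPref

/-- If some two constants are strictly ranked, then all distinct constants are. -/
lemma strictPref_const (h : IsDualPref pref) {a₀ b₀ : ℝ}
    (h₀ : StrictPref pref (fun _ => a₀) (fun _ => b₀)) {a b : ℝ} (hab : b < a) :
    StrictPref pref (fun _ => a) (fun _ => b) := by
  have hd : b₀ < a₀ := by
    by_contra! hle
    exact h₀.2 (h.mono _ _ (const_mem_Qb _) (const_mem_Qb _) fun _ _ => hle)
  have hd' : 0 < a₀ - b₀ := sub_pos.2 hd
  obtain ⟨α, hα, hle⟩ : ∃ α ∈ Ioo (0 : ℝ) 1, α * (a₀ - b₀) ≤ a - b := by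
    refine ⟨min (1 / 2) ((a - b) / (a₀ - b₀)),
      ⟨lt_min (by norm_num) (div_pos (sub_pos.2 hab) hd'),
        (min_le_left _ _).trans_lt (by norm_num)⟩, ?_⟩
    rw [← le_div_iff₀ hd']
    exact min_le_right _ _
  have hα' : (1 : ℝ) - α ≠ 0 := (sub_pos.2 hα.2).ne'
  have key := h.ind _ _ (fun _ => (b - α * b₀) / (1 - α)) (const_mem_Qb a₀) (const_mem_Qb b₀)
    (const_mem_Qb _) h₀ α hα
  have e : (1 - α) * ((b - α * b₀) / (1 - α)) = b - α * b₀ := by field_simp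
  simp only [e, add_sub_cancel] at key
  have hm : pref (fun _ => a) (fun _ => α * a₀ + (b - α * b₀)) :=
    h.mono _ _ (const_mem_Qb _) (const_mem_Qb _) fun _ _ => by nlinarith
  exact ⟨h.mono _ _ (const_mem_Qb _) (const_mem_Qb _) fun _ _ => hab.le, fun hba =>
    key.2 (h.trans _ _ _ (const_mem_Qb _) (const_mem_Qb _) (const_mem_Qb _) hba hm)⟩

lemma strictPref_add_const (h : IsDualPref pref)
    (hc : ∀ a b : ℝ, b < a → StrictPref pref (fun _ => a) (fun _ => b))
    {Φ : ℝ → ℝ} (hΦ : Φ ∈ Qb) {ε : ℝ} (hε : 0 < ε) :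
    StrictPref pref (fun p => Φ p + ε) Φ := by
  have key := h.ind _ _ (fun p => 2 * Φ p) (const_mem_Qb (2 * ε)) (const_mem_Qb 0)
    (const_mul_mem_Qb hΦ zero_le_two) (hc (2 * ε) 0 (by positivity)) (1 / 2) (by norm_num)
  convert key using 2 <;> ring

/-- The weak form of dual independence. -/
lemma mix (h : IsDualPref pref)
    (hc : ∀ a b : ℝ, b < a → StrictPref pref (fun _ => a) (fun _ => b))
    {Φ Ψ Υ : ℝ → ℝ} (hΦ : Φ ∈ Qb) (hΨ : Ψ ∈ Qb) (hΥ : Υ ∈ Qb) (hp : pref Φ Ψ)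
    {α : ℝ} (hα : α ∈ Ioo (0 : ℝ) 1) :
    pref (fun p => α * Φ p + (1 - α) * Υ p) (fun p => α * Ψ p + (1 - α) * Υ p) := by
  have hΦα := mix_mem_Qb hΦ hΥ hα
  refine (h.cont _ (mix_mem_Qb hΨ hΥ hα) _ _
    (fun n => add_mem_Qb hΦα (const_mem_Qb (α * (1 / ((n : ℝ) + 1))))) hΦα
    (unifTendsto_add_const_div α)).2 fun n => ?_
  have hΦn := add_mem_Qb hΦ (const_mem_Qb (1 / ((n : ℝ) + 1)))
  have hs := h.strictPref_add_const hc hΦ (ε := 1 / ((n : ℝ) + 1)) (by positivity)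
  have hs' : StrictPref pref (fun p => Φ p + 1 / ((n : ℝ) + 1)) Ψ :=
    ⟨h.trans _ _ _ hΦn hΦ hΨ hs.1 hp, fun hn => hs.2 (h.trans _ _ _ hΦ hΨ hΦn hp hn)⟩
  convert (h.ind _ _ Υ hΦn hΨ hΥ hs' α hα).1 using 2
  ring

/-- Every prospect has a certainty equivalent. -/
lemma exists_certaintyEquivalent (h : IsDualPref pref)
    (hc : ∀ a b : ℝ, b < a → StrictPref pref (fun _ => a) (fun _ => b))
    {Φ : ℝ → ℝ} (hΦ : Φ ∈ Qb) : ∃ c : ℝ, pref Φ (fun _ => c) ∧ pref (fun _ => c) Φ := by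
  obtain ⟨C, hC⟩ := hΦ.1
  set S : Set ℝ := {c | pref Φ (fun _ => c)}
  have hne : S.Nonempty :=
    ⟨-C, h.mono _ _ hΦ (const_mem_Qb _) fun p hp => (abs_le.1 (hC p hp)).1⟩
  have hbdd : BddAbove S := by
    refine ⟨C, fun c hcS => ?_⟩
    by_contra! hlt
    exact (hc c C hlt).2 (h.trans _ _ _ (const_mem_Qb _) hΦ (const_mem_Qb _)
      (h.mono _ _ (const_mem_Qb _) hΦ fun p hp => (abs_le.1 (hC p hp)).2) hcS)
  refine ⟨sSup S, ?_, ?_⟩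
  · refine (h.cont Φ hΦ _ _ (fun n => const_mem_Qb _) (const_mem_Qb _)
      (unifTendsto_add_const_div (Φ := fun _ => sSup S) (-1))).1 fun n => ?_
    have hn : (0 : ℝ) < 1 / ((n : ℝ) + 1) := by positivity
    obtain ⟨c, hcS, hlt⟩ := exists_lt_of_lt_csSup hne
      (show sSup S + -1 * (1 / ((n : ℝ) + 1)) < sSup S by linarith)
    exact h.trans _ _ _ hΦ (const_mem_Qb _) (const_mem_Qb _) hcS (hc _ _ hlt).1
  · refine (h.cont Φ hΦ _ _ (fun n => const_mem_Qb _) (const_mem_Qb _)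
      (unifTendsto_add_const_div (Φ := fun _ => sSup S) 1)).2 fun n => ?_
    have hn : (0 : ℝ) < 1 / ((n : ℝ) + 1) := by positivity
    refine (h.total _ _ hΦ (const_mem_Qb _)).resolve_left fun hp => ?_
    have := le_csSup hbdd (show sSup S + 1 * (1 / ((n : ℝ) + 1)) ∈ S from hp)
    linarith

/-- A nontrivial dual preference is represented by a functional on `Q_b` which is additive,
positively homogeneous and satisfies `V Φ ≤ V Ψ + c` whenever `Φ ≤ Ψ + c`. -/
lemma exists_representation (h : IsDualPref pref)
    (hc : ∀ a b : ℝ, b < a → StrictPref pref (fun _ => a) (fun _ => b)) :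
    ∃ V : (ℝ → ℝ) → ℝ,
      (∀ Φ ∈ Qb, ∀ Ψ ∈ Qb, pref Φ Ψ ↔ V Ψ ≤ V Φ) ∧
      (∀ Φ ∈ Qb, ∀ Ψ ∈ Qb, V (fun p => Φ p + Ψ p) = V Φ + V Ψ) ∧
      (∀ Φ ∈ Qb, ∀ t : ℝ, 0 < t → V (fun p => t * Φ p) = t * V Φ) ∧
      (∀ Φ ∈ Qb, ∀ Ψ ∈ Qb, ∀ c : ℝ, (∀ p ∈ Ioc (0 : ℝ) 1, Φ p ≤ Ψ p + c) → V Φ ≤ V Ψ + c) := by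
  choose! V hV using fun Φ (hΦ : Φ ∈ Qb) => h.exists_certaintyEquivalent hc hΦ
  have hconst : ∀ a b : ℝ, pref (fun _ => a) (fun _ => b) ↔ b ≤ a := fun a b =>
    ⟨fun hp => not_lt.1 fun hlt => (hc b a hlt).2 hp,
      fun hle => h.mono _ _ (const_mem_Qb _) (const_mem_Qb _) fun _ _ => hle⟩
  have hrep : ∀ Φ ∈ Qb, ∀ Ψ ∈ Qb, pref Φ Ψ ↔ V Ψ ≤ V Φ := fun Φ hΦ Ψ hΨ => by
    have cΦ := const_mem_Qb (V Φ)
    have cΨ := const_mem_Qb (V Ψ)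
    rw [← hconst]
    exact ⟨fun hp => h.trans _ _ _ cΦ hΨ cΨ (h.trans _ _ _ cΦ hΦ hΨ (hV Φ hΦ).2 hp) (hV Ψ hΨ).1,
      fun hp => h.trans _ _ _ hΦ cΨ hΨ (h.trans _ _ _ hΦ cΦ cΨ (hV Φ hΦ).1 hp) (hV Ψ hΨ).2⟩
  have hVc : ∀ c : ℝ, V (fun _ => c) = c := fun c =>
    le_antisymm ((hconst _ _).1 (hV _ (const_mem_Qb c)).1) ((hconst _ _).1 (hV _ (const_mem_Qb c)).2)
  have hmix : ∀ Φ ∈ Qb, ∀ Ψ ∈ Qb, ∀ α ∈ Ioo (0 : ℝ) 1,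
      V (fun p => α * Φ p + (1 - α) * Ψ p) = α * V Φ + (1 - α) * V Ψ := by
    have heq : ∀ Φ ∈ Qb, ∀ Ψ ∈ Qb, ∀ α ∈ Ioo (0 : ℝ) 1,
        V (fun p => α * Φ p + (1 - α) * Ψ p) = V (fun p => α * V Φ + (1 - α) * Ψ p) :=
      fun Φ hΦ Ψ hΨ α hα => by
        have cΦ := const_mem_Qb (V Φ)
        exact le_antisymm
          ((hrep _ (mix_mem_Qb cΦ hΨ hα) _ (mix_mem_Qb hΦ hΨ hα)).1
            (h.mix hc cΦ hΦ hΨ (hV Φ hΦ).2 hα))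
          ((hrep _ (mix_mem_Qb hΦ hΨ hα) _ (mix_mem_Qb cΦ hΨ hα)).1
            (h.mix hc hΦ cΦ hΨ (hV Φ hΦ).1 hα))
    intro Φ hΦ Ψ hΨ α hα
    have hα' : 1 - α ∈ Ioo (0 : ℝ) 1 := ⟨sub_pos.2 hα.2, by linarith [hα.1]⟩
    have h2 := heq Ψ hΨ _ (const_mem_Qb (V Φ)) (1 - α) hα'
    simp only [sub_sub_cancel, hVc] at h2
    rw [heq Φ hΦ Ψ hΨ α hα, ← add_comm ((1 - α) * V Ψ), ← h2]
    simp only [add_comm]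
  have hsmul_lt : ∀ Φ ∈ Qb, ∀ t ∈ Ioo (0 : ℝ) 1, V (fun p => t * Φ p) = t * V Φ :=
    fun Φ hΦ t ht => by
      have := hmix Φ hΦ _ (const_mem_Qb 0) t ht
      simpa [hVc] using this
  have hsmul : ∀ Φ ∈ Qb, ∀ t : ℝ, 0 < t → V (fun p => t * Φ p) = t * V Φ := by
    intro Φ hΦ t ht
    rcases lt_trichotomy t 1 with h1 | rfl | h1
    · exact hsmul_lt Φ hΦ t ⟨ht, h1⟩
    · simp
    · have := hsmul_lt _ (const_mul_mem_Qb hΦ ht.le) t⁻¹ ⟨inv_pos.2 ht, inv_lt_one_of_one_lt₀ h1⟩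
      simp only [inv_mul_cancel_left₀ ht.ne'] at this
      rw [this, mul_inv_cancel_left₀ ht.ne']
  have hadd : ∀ Φ ∈ Qb, ∀ Ψ ∈ Qb, V (fun p => Φ p + Ψ p) = V Φ + V Ψ := by
    intro Φ hΦ Ψ hΨ
    have h1 := hmix _ (const_mul_mem_Qb hΦ zero_le_two) _ (const_mul_mem_Qb hΨ zero_le_two)
      (1 / 2) (by norm_num)
    rw [hsmul Φ hΦ 2 two_pos, hsmul Ψ hΨ 2 two_pos] at h1
    have e : (fun p => (1 / 2 : ℝ) * (2 * Φ p) + (1 - 1 / 2) * (2 * Ψ p)) =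
        fun p => Φ p + Ψ p := by
      funext p; ring
    rw [e] at h1
    linarith
  refine ⟨V, hrep, hadd, hsmul, fun Φ hΦ Ψ hΨ c hle => ?_⟩
  have hΨc := add_mem_Qb hΨ (const_mem_Qb c)
  have := (hrep _ hΨc _ hΦ).1 (h.mono _ _ hΨc hΦ hle)
  rwa [hadd Ψ hΨ _ (const_mem_Qb c), hVc] at this

end IsDualPref

end Preference

section Extension

/-- The real functions that are bounded on `(0,1]`. -/
def boundedFn : Submodule ℝ (ℝ → ℝ) where
  carrier := {f | ∃ C : ℝ, ∀ p ∈ Ioc (0 : ℝ) 1, |f p| ≤ C}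
  zero_mem' := ⟨0, fun _ _ => by simp⟩
  add_mem' := by
    rintro f g ⟨C, hC⟩ ⟨D, hD⟩
    exact ⟨C + D, fun p hp => (abs_add_le _ _).trans (add_le_add (hC p hp) (hD p hp))⟩
  smul_mem' := by
    rintro c f ⟨C, hC⟩
    refine ⟨|c| * C, fun p hp => ?_⟩
    rw [Pi.smul_apply, smul_eq_mul, abs_mul]
    exact mul_le_mul_of_nonneg_left (hC p hp) (abs_nonneg c)

/-- The bounded functions that agree on `(0,1]` with a difference of two prospects. -/
def prospectSpan : Submodule ℝ boundedFn where
  carrier := {f | ∃ Φ ∈ Qb, ∃ Ψ ∈ Qb, ∀ p ∈ Ioc (0 : ℝ) 1, f.1 p = Φ p - Ψ p}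
  zero_mem' := ⟨_, const_mem_Qb 0, _, const_mem_Qb 0, fun _ _ => by simp⟩
  add_mem' := by
    rintro f g ⟨Φ, hΦ, Ψ, hΨ, hf⟩ ⟨Φ', hΦ', Ψ', hΨ', hg⟩
    refine ⟨_, add_mem_Qb hΦ hΦ', _, add_mem_Qb hΨ hΨ', fun p hp => ?_⟩
    rw [Submodule.coe_add, Pi.add_apply, hf p hp, hg p hp]
    ring
  smul_mem' := by
    rintro c f ⟨Φ, hΦ, Ψ, hΨ, hf⟩
    rcases le_total 0 c with hc | hc
    · refine ⟨_, const_mul_mem_Qb hΦ hc, _, const_mul_mem_Qb hΨ hc, fun p hp => ?_⟩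
      rw [Submodule.coe_smul, Pi.smul_apply, hf p hp, smul_eq_mul]
      ring
    · refine ⟨_, const_mul_mem_Qb hΨ (neg_nonneg.2 hc), _, const_mul_mem_Qb hΦ (neg_nonneg.2 hc),
        fun p hp => ?_⟩
      rw [Submodule.coe_smul, Pi.smul_apply, hf p hp, smul_eq_mul]
      ring

/-- The supremum over `(0,1]`. -/
noncomputable def supFn (f : ℝ → ℝ) : ℝ := ⨆ p : Ioc (0 : ℝ) 1, f p.1

lemma nonempty_Ioc_zero_one : Nonempty (Ioc (0 : ℝ) 1) := ⟨⟨1, by norm_num⟩⟩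

lemma supFn_le {f : ℝ → ℝ} {C : ℝ} (h : ∀ p ∈ Ioc (0 : ℝ) 1, f p ≤ C) : supFn f ≤ C :=
  have := nonempty_Ioc_zero_one
  ciSup_le fun p => h p.1 p.2

lemma le_supFn {f : ℝ → ℝ} (hf : f ∈ boundedFn) {p : ℝ} (hp : p ∈ Ioc (0 : ℝ) 1) :
    f p ≤ supFn f := by
  obtain ⟨C, hC⟩ := hf
  refine le_ciSup (f := fun p : Ioc (0 : ℝ) 1 => f p.1) ⟨C, ?_⟩ ⟨p, hp⟩
  rintro _ ⟨q, rfl⟩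
  exact (le_abs_self _).trans (hC q.1 q.2)

lemma supFn_smul {c : ℝ} (hc : 0 < c) (f : ℝ → ℝ) : supFn (c • f) = c * supFn f :=
  (Real.mul_iSup_of_nonneg hc.le _).symm

lemma supFn_add_le {f g : ℝ → ℝ} (hf : f ∈ boundedFn) (hg : g ∈ boundedFn) :
    supFn (f + g) ≤ supFn f + supFn g :=
  supFn_le fun _ hp => add_le_add (le_supFn hf hp) (le_supFn hg hp)

/-- A functional on the cone `Q_b` dominated by the supremum extends to a linear functional on
the bounded functions dominated by the supremum. -/
lemma exists_linear_extension {V : (ℝ → ℝ) → ℝ}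
    (hadd : ∀ Φ ∈ Qb, ∀ Ψ ∈ Qb, V (fun p => Φ p + Ψ p) = V Φ + V Ψ)
    (hsmul : ∀ Φ ∈ Qb, ∀ t : ℝ, 0 < t → V (fun p => t * Φ p) = t * V Φ)
    (hdom : ∀ Φ ∈ Qb, ∀ Ψ ∈ Qb, ∀ c : ℝ, (∀ p ∈ Ioc (0 : ℝ) 1, Φ p ≤ Ψ p + c) →
      V Φ ≤ V Ψ + c) :
    ∃ L : boundedFn →ₗ[ℝ] ℝ, (∀ f, L f ≤ supFn f) ∧ ∀ Φ (hΦ : Φ ∈ Qb), L ⟨Φ, hΦ.1⟩ = V Φ := by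
  have hV0 : V (fun _ => 0) = 0 := by
    have := hadd _ (const_mem_Qb 0) _ (const_mem_Qb 0)
    simp only [add_zero] at this
    linarith
  have hsmul0 : ∀ Φ ∈ Qb, ∀ t : ℝ, 0 ≤ t → V (fun p => t * Φ p) = t * V Φ := by
    intro Φ hΦ t ht
    rcases ht.eq_or_lt with rfl | ht
    · simpa using hV0
    · exact hsmul Φ hΦ t ht
  have hdiff : ∀ Φ ∈ Qb, ∀ Ψ ∈ Qb, ∀ Φ' ∈ Qb, ∀ Ψ' ∈ Qb,
      (∀ p ∈ Ioc (0 : ℝ) 1, Φ p - Ψ p = Φ' p - Ψ' p) → V Φ - V Ψ = V Φ' - V Ψ' := by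
    intro Φ hΦ Ψ hΨ Φ' hΦ' Ψ' hΨ' he
    have h1 := hdom _ (add_mem_Qb hΦ hΨ') _ (add_mem_Qb hΦ' hΨ) 0
      fun p hp => by linarith [he p hp]
    have h2 := hdom _ (add_mem_Qb hΦ' hΨ) _ (add_mem_Qb hΦ hΨ') 0
      fun p hp => by linarith [he p hp]
    rw [hadd Φ hΦ Ψ' hΨ', hadd Φ' hΦ' Ψ hΨ] at h1 h2
    linarith
  choose P hP N hN hPN using fun f : prospectSpan => f.2
  let L₀ : prospectSpan →ₗ[ℝ] ℝ :=
    { toFun := fun f => V (P f) - V (N f)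
      map_add' := fun f g => by
        have := hdiff _ (hP (f + g)) _ (hN (f + g)) _ (add_mem_Qb (hP f) (hP g)) _
          (add_mem_Qb (hN f) (hN g)) fun p hp => by
            rw [← hPN (f + g) p hp, add_sub_add_comm, ← hPN f p hp, ← hPN g p hp]
            rfl
        rw [this, hadd _ (hP f) _ (hP g), hadd _ (hN f) _ (hN g)]
        ring
      map_smul' := fun c f => by
        rw [RingHom.id_apply, smul_eq_mul]
        have hcf : ∀ p ∈ Ioc (0 : ℝ) 1, P (c • f) p - N (c • f) p = c * (P f p - N f p) :=
          fun p hp => by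
            rw [← hPN (c • f) p hp, ← hPN f p hp]
            rfl
        rcases le_total 0 c with hc | hc
        · have := hdiff _ (hP (c • f)) _ (hN (c • f)) _ (const_mul_mem_Qb (hP f) hc) _
            (const_mul_mem_Qb (hN f) hc) fun p hp => by rw [hcf p hp]; ring
          rw [this, hsmul0 _ (hP f) c hc, hsmul0 _ (hN f) c hc]
          ring
        · have hc' := neg_nonneg.2 hc
          have := hdiff _ (hP (c • f)) _ (hN (c • f)) _ (const_mul_mem_Qb (hN f) hc') _
            (const_mul_mem_Qb (hP f) hc') fun p hp => by rw [hcf p hp]; ring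
          rw [this, hsmul0 _ (hP f) _ hc', hsmul0 _ (hN f) _ hc']
          ring }
  obtain ⟨L, hL, hle⟩ := exists_extension_of_le_sublinear
    (⟨prospectSpan, L₀⟩ : boundedFn →ₗ.[ℝ] ℝ) (fun f => supFn f)
    (fun c hc f => supFn_smul hc f) (fun f g => supFn_add_le f.2 g.2) fun f => by
      have := hdom _ (hP f) _ (hN f) (supFn (f : boundedFn)) fun p hp => by
        linarith [hPN f p hp, le_supFn (f : boundedFn).2 hp]
      exact sub_le_iff_le_add'.2 this
  refine ⟨L, hle, fun Φ hΦ => ?_⟩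
  have hmem : (⟨Φ, hΦ.1⟩ : boundedFn) ∈ prospectSpan :=
    ⟨Φ, hΦ, _, const_mem_Qb 0, fun _ _ => by simp⟩
  have h1 := hL ⟨_, hmem⟩
  have h2 := hdiff _ (hP ⟨_, hmem⟩) _ (hN ⟨_, hmem⟩) _ hΦ _ (const_mem_Qb 0)
    fun p hp => by rw [← hPN ⟨_, hmem⟩ p hp, sub_zero]
  rw [hV0, sub_zero] at h2
  exact h1.trans h2

lemma indicator_mem_boundedFn (A : Set ℝ) (c : ℝ) : A.indicator (fun _ => c) ∈ boundedFn :=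
  ⟨|c|, fun p _ => by by_cases hp : p ∈ A <;> simp [hp]⟩

lemma mem_boundedFn_of_isSimpleFn {f : ℝ → ℝ} (hf : IsSimpleFn f) : f ∈ boundedFn := by
  obtain ⟨n, c, A, -, -, h⟩ := hf
  obtain ⟨C, hC⟩ : (∑ i, (A i).indicator (fun _ => c i)) ∈ boundedFn :=
    Submodule.sum_mem _ fun i _ => indicator_mem_boundedFn _ _
  refine ⟨C, fun p hp => ?_⟩
  rw [h p hp, ← Finset.sum_apply]
  exact hC p hp

lemma mem_boundedFn_of_mem_BSpace {f : ℝ → ℝ} (hf : f ∈ BSpace) : f ∈ boundedFn := by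
  obtain ⟨g, hg, hlim⟩ := hf
  obtain ⟨N, hN⟩ := hlim 1 one_pos
  obtain ⟨C, hC⟩ := mem_boundedFn_of_isSimpleFn (hg N)
  refine ⟨C + 1, fun p hp => ?_⟩
  have h1 := abs_le.1 (hN N le_rfl p hp)
  have h2 := abs_le.1 (hC p hp)
  exact abs_le.2 ⟨by linarith [h1.2, h2.1], by linarith [h1.1, h2.2]⟩

end Extension

/-- Integral representation of dual utility with respect to a nonnegative, bounded,
finitely additive measure on `Σ`: a continuous, monotonic total preorder on `Q_b`
satisfying the dual independence axiom is represented by a continuous linear functional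
on `B((0,1],Σ)` which is the integral with respect to such a measure. -/
theorem exists_finitely_additive_integral_representation
    (pref : (ℝ → ℝ) → (ℝ → ℝ) → Prop)
    (hrefl : ∀ Φ ∈ Qb, pref Φ Φ)
    (htrans : ∀ Φ Ψ Υ, Φ ∈ Qb → Ψ ∈ Qb → Υ ∈ Qb → pref Φ Ψ → pref Ψ Υ → pref Φ Υ)
    (htotal : ∀ Φ Ψ, Φ ∈ Qb → Ψ ∈ Qb → pref Φ Ψ ∨ pref Ψ Φ)
    (hmono : ∀ Φ Ψ, Φ ∈ Qb → Ψ ∈ Qb → (∀ p ∈ Set.Ioc (0:ℝ) 1, Ψ p ≤ Φ p) → pref Φ Ψ)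
    (hcont : ∀ Φ ∈ Qb, ∀ (Ψs : ℕ → ℝ → ℝ) (Ψ : ℝ → ℝ), (∀ n, Ψs n ∈ Qb) → Ψ ∈ Qb →
      UnifTendsto Ψs Ψ →
      ((∀ n, pref Φ (Ψs n)) → pref Φ Ψ) ∧ ((∀ n, pref (Ψs n) Φ) → pref Ψ Φ))
    (hind : ∀ Φ Ψ Υ, Φ ∈ Qb → Ψ ∈ Qb → Υ ∈ Qb → StrictPref pref Φ Ψ →
      ∀ α ∈ Set.Ioo (0:ℝ) 1,
        StrictPref pref (fun p => α * Φ p + (1 - α) * Υ p)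
          (fun p => α * Ψ p + (1 - α) * Υ p)) :
    ∃ (U : (ℝ → ℝ) → ℝ) (m : Set ℝ → ℝ),
      (∀ A ∈ SigmaAlg, 0 ≤ m A) ∧
      (∃ C : ℝ, ∀ A ∈ SigmaAlg, m A ≤ C) ∧
      (∀ A B, A ∈ SigmaAlg → B ∈ SigmaAlg → Disjoint A B → m (A ∪ B) = m A + m B) ∧
      (∀ f g, f ∈ BSpace → g ∈ BSpace → ∀ a b : ℝ,
        U (fun p => a * f p + b * g p) = a * U f + b * U g) ∧
      (∃ C : ℝ, ∀ f ∈ BSpace, |U f| ≤ C * supAbs f) ∧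
      (∀ (n : ℕ) (c : Fin n → ℝ) (A : Fin n → Set ℝ), (∀ i, A i ∈ SigmaAlg) →
        (∀ i j, i ≠ j → Disjoint (A i) (A j)) →
        U (fun p => ∑ i, Set.indicator (A i) (fun _ => c i) p) = ∑ i, c i * m (A i)) ∧
      (∀ Φ Ψ, Φ ∈ Qb → Ψ ∈ Qb → (StrictPref pref Φ Ψ ↔ U Φ > U Ψ)) := by
  classical
  have h : IsDualPref pref := ⟨hrefl, htrans, htotal, hmono, hcont, hind⟩
  by_cases h₀ : ∃ a b : ℝ, StrictPref pref (fun _ => a) (fun _ => b)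
  · obtain ⟨a₀, b₀, h₀⟩ := h₀
    obtain ⟨V, hrep, hadd, hsmul, hdom⟩ :=
      h.exists_representation fun a b hab => h.strictPref_const h₀ hab
    obtain ⟨L, hle, hLV⟩ := exists_linear_extension hadd hsmul hdom
    let U : (ℝ → ℝ) → ℝ := fun f => if hf : f ∈ boundedFn then L ⟨f, hf⟩ else 0
    have hU : ∀ f (hf : f ∈ boundedFn), U f = L ⟨f, hf⟩ := fun f hf => dif_pos hf
    have hUV : ∀ Φ ∈ Qb, U Φ = V Φ := fun Φ hΦ => (hU Φ hΦ.1).trans (hLV Φ hΦ)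
    let m : Set ℝ → ℝ := fun A => U (A.indicator fun _ => 1)
    have hm : ∀ A : Set ℝ, m A =
        L ⟨A.indicator fun _ => 1, indicator_mem_boundedFn A 1⟩ := fun A => hU _ _
    refine ⟨U, m, fun A _ => ?_, ⟨1, fun A _ => ?_⟩,
      fun A B _ _ hAB => ?_, fun f g hf hg a b => ?_, ⟨1, fun f hf => ?_⟩,
      fun n c A _ _ => ?_, fun Φ Ψ hΦ hΨ => ?_⟩
    · have := hle (-⟨A.indicator fun _ => 1, indicator_mem_boundedFn A 1⟩)
      rw [map_neg] at this
      have h0 : supFn (-A.indicator fun _ => (1 : ℝ)) ≤ 0 := supFn_le fun p _ =>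
        neg_nonpos.2 (indicator_nonneg (fun _ _ => zero_le_one) p)
      rw [hm]
      exact neg_nonpos.1 (this.trans h0)
    · rw [hm]
      exact (hle _).trans (supFn_le fun p _ =>
        indicator_le_self' (fun _ _ => zero_le_one) p)
    · rw [hm, hm, hm, ← map_add]
      congr 1
      exact Subtype.ext (indicator_union_of_disjoint hAB _)
    · have hf' := mem_boundedFn_of_mem_BSpace hf
      have hg' := mem_boundedFn_of_mem_BSpace hg
      rw [hU f hf', hU g hg', ← smul_eq_mul, ← smul_eq_mul, ← map_smul, ← map_smul, ← map_add]
      exact hU _ (a • (⟨f, hf'⟩ : boundedFn) + b • (⟨g, hg'⟩ : boundedFn)).2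
    · have hf' := mem_boundedFn_of_mem_BSpace hf
      have habs : (fun p => |f p|) ∈ boundedFn := by simpa [boundedFn] using hf'
      rw [one_mul, hU f hf', abs_le']
      refine ⟨(hle _).trans (supFn_le fun p hp => ?_), ?_⟩
      · exact (le_abs_self _).trans (le_supFn habs hp)
      · rw [← map_neg]
        refine (hle _).trans (supFn_le fun p hp => ?_)
        exact (neg_le_abs _).trans (le_supFn habs hp)
    · let e : Fin n → boundedFn := fun i =>
        ⟨(A i).indicator fun _ => 1, indicator_mem_boundedFn (A i) 1⟩
      have he : (fun p => ∑ i, (A i).indicator (fun _ => c i) p) = (∑ i, c i • e i : boundedFn) := by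
        funext p
        simp [e, indicator_apply, Finset.sum_apply]
      rw [he, hU _ (∑ i, c i • e i : boundedFn).2, Subtype.coe_eta, map_sum]
      refine Finset.sum_congr rfl fun i _ => ?_
      rw [map_smul, smul_eq_mul, hm]
    · rw [StrictPref, hrep Φ hΦ Ψ hΨ, hrep Ψ hΨ Φ hΦ, hUV Φ hΦ, hUV Ψ hΨ, not_le, gt_iff_lt]
      exact ⟨fun h => h.2, fun h => ⟨h.le, h⟩⟩
  · refine ⟨fun _ => 0, fun _ => 0, by simp, ⟨0, by simp⟩, by simp, by simp, ⟨0, by simp⟩,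
      by simp, fun Φ Ψ hΦ hΨ => ?_⟩
    simp only [gt_iff_lt, lt_irrefl, iff_false]
    intro hs
    obtain ⟨C, hC⟩ := hΦ.1
    obtain ⟨D, hD⟩ := hΨ.1
    have hCΦ : pref (fun _ => C) Φ :=
      hmono _ _ (const_mem_Qb C) hΦ fun p hp => (abs_le.1 (hC p hp)).2
    have hΨD : pref Ψ (fun _ => -D) :=
      hmono _ _ hΨ (const_mem_Qb _) fun p hp => (abs_le.1 (hD p hp)).1
    refine h₀ ⟨C, -D, htrans _ _ _ (const_mem_Qb _) hΨ (const_mem_Qb _)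
      (htrans _ _ _ (const_mem_Qb _) hΦ hΨ hCΦ hs.1) hΨD, fun hDC => hs.2 ?_⟩
    exact htrans _ _ _ hΨ (const_mem_Qb _) hΦ hΨD
      (htrans _ _ _ (const_mem_Qb _) (const_mem_Qb _) hΦ hDC hCΦ)
end
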